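/- Lemma (existence of a locally exponentially stable sandwiched compact set). Consider ż = F(z) with F smooth on ℝ^m, evolving on an invariant closed set 𝒞 ⊆ ℝ^m. Let 𝒜 ⊆ 𝒞 be a compact set which is locally asymptotically stable for this system with domain of attraction 𝒟(𝒜) ⊆ 𝒞. Then for every compact set 𝒮 ⊆ 𝒞 with 𝒜 ⊆ int 𝒮, there exists a compact set ℛ satisfying 𝒜 ⊆ ℛ ⊆ 𝒮 which is locally exponentially stable for ż = F(z) with domain of attraction 𝒟(ℛ) = 𝒟(𝒜). -/

import Mathlib

open Set Metric Filter

noncomputable section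

/-- `ℝ^m` with the Euclidean norm. -/
abbrev Euc (m : ℕ) : Type := EuclideanSpace ℝ (Fin m)

section Defs

variable {α : Type*} [NormedAddCommGroup α] [NormedSpace ℝ α]

/-- `φ` is a forward-complete solution flow of the vector field `F`:
`φ 0 z = z` and `∂φ/∂t (t,z) = F (φ t z)` for `t ≥ 0`. -/
def IsFlowOf (F : α → α) (φ : ℝ → α → α) : Prop :=
  (∀ z, φ 0 z = z) ∧
    ∀ z, ∀ t ∈ Ici (0:ℝ), HasDerivWithinAt (fun s => φ s z) (F (φ t z)) (Ici 0) t

/-- `z : ℝ → α` is a (forward) solution of `ż = F z`. -/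
def IsSolOf (F : α → α) (z : ℝ → α) : Prop :=
  ∀ t ∈ Ici (0:ℝ), HasDerivWithinAt z (F (z t)) (Ici 0) t

/-- Lyapunov stability of the set `A` for the flow `φ`. -/
def StableSet (φ : ℝ → α → α) (A : Set α) : Prop :=
  ∀ ε > 0, ∃ δ > 0, ∀ z, infDist z A < δ → ∀ t ≥ (0:ℝ), infDist (φ t z) A < ε

/-- The set `A` attracts (for the flow `φ`) every trajectory starting in `X`. -/
def AttractsFrom (φ : ℝ → α → α) (A X : Set α) : Prop :=
  ∀ z ∈ X, Tendsto (fun t => infDist (φ t z) A) atTop (nhds 0)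

/-- Local exponential estimate: `dist(φ t z, A) ≤ N e^{-λ t} dist(z, A)` near `A`. -/
def ExpBound (φ : ℝ → α → α) (A : Set α) : Prop :=
  ∃ N > (0:ℝ), ∃ lam > (0:ℝ), ∃ d > (0:ℝ), ∀ z, infDist z A ≤ d → ∀ t ≥ (0:ℝ),
    infDist (φ t z) A ≤ N * Real.exp (-lam * t) * infDist z A

/-- `A` is LAS(`X`): locally asymptotically stable with domain of attraction containing `X`. -/
def IsLASOn (φ : ℝ → α → α) (A X : Set α) : Prop :=
  StableSet φ A ∧ AttractsFrom φ A X

/-- `A` is LES(`X`). -/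
def IsLESOn (φ : ℝ → α → α) (A X : Set α) : Prop :=
  IsLASOn φ A X ∧ ExpBound φ A

/-- `A` is locally asymptotically stable (attracting some neighborhood of itself). -/
def IsLAS (φ : ℝ → α → α) (A : Set α) : Prop :=
  StableSet φ A ∧ ∃ U, IsOpen U ∧ A ⊆ U ∧ AttractsFrom φ A U

/-- `A` is locally exponentially stable. -/
def IsLES (φ : ℝ → α → α) (A : Set α) : Prop :=
  IsLAS φ A ∧ ExpBound φ A

/-- Domain of attraction of the set `A` for the flow `φ`. -/
def DomAttr (φ : ℝ → α → α) (A : Set α) : Set α :=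
  {z | Tendsto (fun t => infDist (φ t z) A) atTop (nhds 0)}

/-- `ψ` is a complete vector field: it admits a global (two-sided) flow. -/
def IsCompleteVF (ψ : α → α) : Prop :=
  ∃ Φ : ℝ → α → α, (∀ x, Φ 0 x = x) ∧ ∀ x t, HasDerivAt (fun s => Φ s x) (ψ (Φ t x)) t

end Defs

/-- Class-`𝒦` function. -/
def IsClassK (f : ℝ → ℝ) : Prop :=
  Continuous f ∧ StrictMonoOn f (Ici 0) ∧ f 0 = 0

/-- Class-`𝒦ℒ` function. -/
def IsClassKL (β : ℝ → ℝ → ℝ) : Prop :=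
  Continuous (fun p : ℝ × ℝ => β p.1 p.2) ∧
  (∀ t, StrictMonoOn (β t) (Ici 0) ∧ β t 0 = 0) ∧
  (∀ s, AntitoneOn (fun t => β t s) (Ici 0) ∧ Tendsto (fun t => β t s) atTop (nhds 0))

/-- Locally exponential class-`𝒦ℒ` function. -/
def IsLocExpKL (β : ℝ → ℝ → ℝ) : Prop :=
  ∃ d > (0:ℝ), ∃ N > (0:ℝ), ∃ lam > (0:ℝ), ∀ t ≥ (0:ℝ), ∀ s ∈ Icc (0:ℝ) d,
    β t s ≤ N * Real.exp (-lam * t) * s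

/-- Locally (essentially) bounded signal. -/
def LocBdd (v : ℝ → ℝ) : Prop :=
  ∀ K : Set ℝ, IsCompact K → ∃ M, ∀ t ∈ K, |v t| ≤ M

section LER

variable {α : Type*} [NormedAddCommGroup α] [NormedSpace ℝ α]

/-- The graph of `T` restricted to `R`, i.e. `{(T z, z) : z ∈ R}`. -/
def graphOn {p : ℕ} (T : α → Euc p) (R : Set α) : Set (Euc p × α) :=
  {w | ∃ z ∈ R, w = (T z, z)}

/-- The reproduction estimate: every solution of `ż = F z`, `ξ̇ = phi ξ + ψ ξ · Q z`
with `z 0 ∈ Z` converges to `graph T|_R` according to the `𝒦ℒ`-bound `β`. -/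
def ReproEst {p : ℕ} (F : α → α) (Q : α → ℝ) (R Z : Set α)
    (phi : Euc p → Euc p) (psi : Euc p → Euc p) (T : α → Euc p) (β : ℝ → ℝ → ℝ) : Prop :=
  ∀ (z : ℝ → α) (ξ : ℝ → Euc p),
    IsSolOf F z → z 0 ∈ Z →
    (∀ t ∈ Ici (0:ℝ), HasDerivWithinAt ξ (phi (ξ t) + Q (z t) • psi (ξ t)) (Ici 0) t) →
    ∀ t ≥ (0:ℝ),
      infDist (ξ t, z t) (graphOn T R) ≤ β t (infDist (ξ 0, z 0) (graphOn T R))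

/-- The robust (ISS-like) reproduction estimate for the system driven by `Q z + v t`. -/
def RobReproEst {p : ℕ} (F : α → α) (Q : α → ℝ) (R Z : Set α)
    (phi : Euc p → Euc p) (psi : Euc p → Euc p) (T : α → Euc p)
    (β : ℝ → ℝ → ℝ) (l : ℝ → ℝ) : Prop :=
  ∀ v : ℝ → ℝ, LocBdd v →
    ∀ (z : ℝ → α) (ξ : ℝ → Euc p),
      IsSolOf F z → z 0 ∈ Z →
      (∀ t ∈ Ici (0:ℝ),
        HasDerivWithinAt ξ (phi (ξ t) + (Q (z t) + v t) • psi (ξ t)) (Ici 0) t) →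
      ∀ t ≥ (0:ℝ),
        infDist (ξ t, z t) (graphOn T R) ≤
          β t (infDist (ξ 0, z 0) (graphOn T R)) + l (sSup ((fun τ => |v τ|) '' Icc 0 t))

/-- The data `(phi, gamma, psi, T)` witnesses local exponential reproducibility of
`(F, Q)` on `R` for initial conditions in `Z`. -/
def ReproData {p : ℕ} (F : α → α) (Q : α → ℝ) (R Z : Set α)
    (phi : Euc p → Euc p) (gamma : Euc p → ℝ) (psi : Euc p → Euc p) (T : α → Euc p) : Prop :=
  LocallyLipschitz phi ∧ LocallyLipschitz gamma ∧ LocallyLipschitz psi ∧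
  LocallyLipschitz T ∧ IsCompleteVF psi ∧
  (∀ z ∈ R, Q z + gamma (T z) = 0) ∧
  ∃ β : ℝ → ℝ → ℝ, IsClassKL β ∧ IsLocExpKL β ∧ ReproEst F Q R Z phi psi T β

/-- Robust version of `ReproData`. -/
def RobReproData {p : ℕ} (F : α → α) (Q : α → ℝ) (R Z : Set α)
    (phi : Euc p → Euc p) (gamma : Euc p → ℝ) (psi : Euc p → Euc p) (T : α → Euc p) : Prop :=
  LocallyLipschitz phi ∧ LocallyLipschitz gamma ∧ LocallyLipschitz psi ∧
  LocallyLipschitz T ∧ IsCompleteVF psi ∧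
  (∀ z ∈ R, Q z + gamma (T z) = 0) ∧
  ∃ (β : ℝ → ℝ → ℝ) (l : ℝ → ℝ), IsClassKL β ∧ IsLocExpKL β ∧ IsClassK l ∧
    ReproEst F Q R Z phi psi T β ∧ RobReproEst F Q R Z phi psi T β l

/-- The triplet `(F, Q, A)` is Locally Exponentially Reproducible (LER);
`φF` is the flow of `F`. -/
def IsLER (F : α → α) (φF : ℝ → α → α) (Q : α → ℝ) (A : Set α) : Prop :=
  ∃ R : Set α, IsCompact R ∧ A ⊆ R ∧ IsLES φF R ∧
    ∀ Z : Set α, Bornology.IsBounded Z → Z ⊆ DomAttr φF R →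
      ∃ (p : ℕ) (phi : Euc p → Euc p) (gamma : Euc p → ℝ) (psi : Euc p → Euc p)
        (T : α → Euc p), ReproData F Q R Z phi gamma psi T

/-- The triplet `(F, Q, A)` is robustly Locally Exponentially Reproducible (rLER). -/
def IsRLER (F : α → α) (φF : ℝ → α → α) (Q : α → ℝ) (A : Set α) : Prop :=
  ∃ R : Set α, IsCompact R ∧ A ⊆ R ∧ IsLES φF R ∧
    ∀ Z : Set α, Bornology.IsBounded Z → Z ⊆ DomAttr φF R →
      ∃ (p : ℕ) (phi : Euc p → Euc p) (gamma : Euc p → ℝ) (psi : Euc p → Euc p)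
        (T : α → Euc p), RobReproData F Q R Z phi gamma psi T

end LER

/-- Iterated Lie derivative of `g` along the vector field `F`. -/
def lieDIter {α : Type*} [NormedAddCommGroup α] [NormedSpace ℝ α]
    (F : α → α) (g : α → ℝ) : ℕ → α → ℝ
  | 0 => g
  | k+1 => fun z => fderiv ℝ (lieDIter F g k) z (F z)

theorem tendsto_exp_bound (N c : ℝ) {lam : ℝ} (hlam : 0 < lam) :
    Tendsto (fun t : ℝ => N * Real.exp (-lam * t) * c) atTop (nhds 0) := by
  have h : Tendsto (fun t : ℝ => Real.exp (-lam * t)) atTop (nhds 0) :=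
    Real.tendsto_exp_atBot.comp (tendsto_id.const_mul_atTop_of_neg (neg_lt_zero.2 hlam))
  simpa using (h.const_mul N).mul_const c

/-- A local exponential estimate implies local asymptotic stability. -/
theorem ExpBound.isLES {α : Type*} [NormedAddCommGroup α] {φ : ℝ → α → α} {A : Set α}
    (h : ExpBound φ A) : IsLES φ A := by
  refine ⟨?_, h⟩
  obtain ⟨N, hN, lam, hlam, d, hd, hb⟩ := h
  refine ⟨fun ε hε => ⟨min d (ε / N), by positivity, fun z hz t ht => ?_⟩,
    {z | infDist z A < d}, isOpen_lt (continuous_infDist_pt A) continuous_const,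
    fun z hz => by simpa [infDist_zero_of_mem hz] using hd, fun z hz => ?_⟩
  · have hexp : Real.exp (-lam * t) ≤ 1 := Real.exp_le_one_iff.2 (by nlinarith)
    calc infDist (φ t z) A ≤ N * Real.exp (-lam * t) * infDist z A :=
          hb z (hz.le.trans (min_le_left _ _)) t ht
      _ ≤ N * 1 * infDist z A := by gcongr; exact infDist_nonneg
      _ < ε := by
          have := (lt_div_iff₀ hN).1 (hz.trans_le (min_le_right _ _))
          linarith
  · refine squeeze_zero' (Eventually.of_forall fun t => infDist_nonneg) ?_
      (tendsto_exp_bound N (infDist z A) hlam)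
    filter_upwards [eventually_ge_atTop 0] with t ht
    exact hb z (le_of_lt hz) t ht

section Flow

variable {α : Type*} [NormedAddCommGroup α] [NormedSpace ℝ α]

theorem IsSolOf.continuousOn {F : α → α} {x : ℝ → α} (hx : IsSolOf F x) :
    ContinuousOn x (Ici 0) :=
  fun t ht => (hx t ht).continuousWithinAt

theorem IsSolOf.shift {F : α → α} {x : ℝ → α} (hx : IsSolOf F x) {s : ℝ} (hs : 0 ≤ s) :
    IsSolOf F (fun t => x (s + t)) := by
  intro t ht
  have ht' : (0 : ℝ) ≤ t := ht
  have h := (hx (s + t) (add_nonneg hs ht')).scomp t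
    ((hasDerivWithinAt_id t (Ici (0 : ℝ))).const_add s)
    (fun r (hr : (0 : ℝ) ≤ r) => add_nonneg hs hr)
  simpa [Function.comp_def] using h

theorem IsFlowOf.isSolOf {F : α → α} {φ : ℝ → α → α} (hφ : IsFlowOf F φ) (z : α) :
    IsSolOf F (fun t => φ t z) :=
  hφ.2 z

/-- Solutions starting close to a solution that stays in a compact set diverge from it at most
exponentially, with a rate depending only on the compact set. -/
theorem exists_dist_sol_le [ProperSpace α] {F : α → α} (hF : LocallyLipschitz F) {P : Set α}
    (hP : IsCompact P) :
    ∃ L > (0 : ℝ), ∀ (x y : ℝ → α) (T ρ : ℝ), IsSolOf F x → IsSolOf F y →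
      (∀ t ∈ Icc 0 T, y t ∈ P) → 0 < ρ → dist (x 0) (y 0) ≤ ρ → ρ * Real.exp (L * T) ≤ 1 →
      ∀ t ∈ Icc 0 T, dist (x t) (y t) ≤ ρ * Real.exp (L * t) := by
  obtain ⟨K, hK⟩ := (hF.locallyLipschitzOn (s := cthickening 1 P)).exists_lipschitzOnWith_of_compact
    (hP.cthickening (r := 1))
  refine ⟨K + 1, by positivity, fun x y T ρ hx hy hyP hρ h0 hT t ht => ?_⟩
  have hmono : Icc 0 T ⊆ Ici (0 : ℝ) := fun s hs => hs.1
  rw [dist_eq_norm]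
  refine image_norm_le_of_norm_deriv_right_lt_deriv_boundary (f := fun s => x s - y s)
    (f' := fun s => F (x s) - F (y s)) (B := fun s => ρ * Real.exp ((K + 1) * s))
    (B' := fun s => ρ * (Real.exp ((K + 1) * s) * (K + 1)))
    ((hx.continuousOn.mono hmono).sub (hy.continuousOn.mono hmono)) ?_ ?_ ?_ ?_ ht
  · intro s hs
    exact ((hx s hs.1).sub (hy s hs.1)).mono (Ici_subset_Ici.2 hs.1)
  · simpa [dist_eq_norm] using h0
  · intro s
    have h := (((hasDerivAt_id s).const_mul ((K : ℝ) + 1)).exp).const_mul ρ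
    simpa using h
  · intro s hs hB
    have hle : ρ * Real.exp ((K + 1) * s) ≤ 1 := le_trans (by gcongr; exact hs.2.le) hT
    have hyP' := hyP s ⟨hs.1, hs.2.le⟩
    have hxs : x s ∈ cthickening 1 P :=
      mem_cthickening_of_dist_le _ (y s) _ _ hyP' (by rw [dist_eq_norm, hB]; exact hle)
    have hlip := hK.dist_le_mul _ hxs _ (self_subset_cthickening P hyP')
    rw [dist_eq_norm, dist_eq_norm, hB] at hlip
    have : 0 < ρ * Real.exp ((K + 1) * s) := by positivity
    calc ‖F (x s) - F (y s)‖ ≤ K * (ρ * Real.exp ((K + 1) * s)) := hlip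
      _ < ρ * (Real.exp ((K + 1) * s) * (K + 1)) := by linarith

/-- Continuous dependence on the initial condition. -/
theorem exists_dist_sol_le_of_isSolOf [ProperSpace α] {F : α → α} (hF : LocallyLipschitz F)
    {y : ℝ → α} (hy : IsSolOf F y) {T : ℝ} (hT : 0 ≤ T) :
    ∃ L > (0 : ℝ), ∀ x : ℝ → α, IsSolOf F x → ∀ ρ > 0, dist (x 0) (y 0) ≤ ρ →
      ρ * Real.exp (L * T) ≤ 1 → dist (x T) (y T) ≤ ρ * Real.exp (L * T) := by
  obtain ⟨L, hL, h⟩ := exists_dist_sol_le hF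
    ((isCompact_Icc (a := 0) (b := T)).image_of_continuousOn
      (hy.continuousOn.mono fun s hs => hs.1))
  exact ⟨L, hL, fun x hx ρ hρ h0 hρT => h x y T ρ hx hy (fun t ht => mem_image_of_mem y ht) hρ h0
    hρT T ⟨hT, le_rfl⟩⟩

theorem IsSolOf.eq_of_eq_zero [ProperSpace α] {F : α → α} (hF : LocallyLipschitz F)
    {x y : ℝ → α} (hx : IsSolOf F x) (hy : IsSolOf F y) (h0 : x 0 = y 0) {T : ℝ} (hT : 0 ≤ T) :
    x T = y T := by
  obtain ⟨L, -, h⟩ := exists_dist_sol_le_of_isSolOf hF hy hT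
  refine eq_of_forall_dist_le fun ε hε => ?_
  have hE := Real.exp_pos (L * T)
  have hmul : min ε 1 / Real.exp (L * T) * Real.exp (L * T) = min ε 1 := by field_simp
  have := h x hx (min ε 1 / Real.exp (L * T)) (by positivity)
    (by rw [h0, dist_self]; positivity) (hmul.le.trans (min_le_right _ _))
  exact this.trans (hmul.le.trans (min_le_left _ _))

theorem IsFlowOf.map_add [ProperSpace α] {F : α → α} (hF : LocallyLipschitz F)
    {φ : ℝ → α → α} (hφ : IsFlowOf F φ) {s t : ℝ} (hs : 0 ≤ s) (ht : 0 ≤ t) (z : α) :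
    φ (s + t) z = φ t (φ s z) :=
  ((hφ.isSolOf z).shift hs).eq_of_eq_zero hF (hφ.isSolOf (φ s z)) (by simp [hφ.1]) ht

theorem IsFlowOf.continuous [ProperSpace α] {F : α → α} (hF : LocallyLipschitz F)
    {φ : ℝ → α → α} (hφ : IsFlowOf F φ) {t : ℝ} (ht : 0 ≤ t) : Continuous (φ t) := by
  refine Metric.continuous_iff.2 fun y ε hε => ?_
  obtain ⟨L, -, h⟩ := exists_dist_sol_le_of_isSolOf hF (hφ.isSolOf y) ht
  have hE := Real.exp_pos (L * t)
  have hmul : min (ε / 2) 1 / Real.exp (L * t) * Real.exp (L * t) = min (ε / 2) 1 := by field_simp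
  refine ⟨min (ε / 2) 1 / Real.exp (L * t), by positivity, fun x hxy => ?_⟩
  have := h _ (hφ.isSolOf x) (min (ε / 2) 1 / Real.exp (L * t)) (by positivity)
    (by simpa [hφ.1] using hxy.le) (hmul.le.trans (min_le_right _ _))
  have h2 := this.trans (hmul.le.trans (min_le_left _ _))
  linarith

/-- A compact forward invariant set absorbing one of its neighbourhoods in finite time satisfies a
local exponential estimate. -/
theorem IsFlowOf.expBound_of_absorbing [ProperSpace α] {F : α → α} (hF : LocallyLipschitz F)
    {φ : ℝ → α → α} (hφ : IsFlowOf F φ) {R : Set α} (hR : IsCompact R) (hne : R.Nonempty)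
    (hinv : ∀ z ∈ R, ∀ t ≥ (0 : ℝ), φ t z ∈ R) {d T : ℝ} (hd : 0 < d)
    (habs : ∀ z, infDist z R ≤ d → ∀ t ≥ T, φ t z ∈ R) : ExpBound φ R := by
  obtain ⟨L, hL, h⟩ := exists_dist_sol_le hF hR
  refine ⟨Real.exp ((L + 1) * T), Real.exp_pos _, 1, one_pos, min d (Real.exp (-(L * T))),
    lt_min hd (Real.exp_pos _), fun z hz t ht => ?_⟩
  have hnonneg : 0 ≤ Real.exp ((L + 1) * T) * Real.exp (-1 * t) * infDist z R :=
    mul_nonneg (by positivity) infDist_nonneg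
  rcases le_total T t with hTt | htT
  · rwa [infDist_zero_of_mem (habs z (hz.trans (min_le_left _ _)) t hTt)]
  obtain ⟨r, hr, hzr⟩ := hR.exists_infDist_eq_dist hne z
  rcases (infDist_nonneg (x := z) (s := R)).eq_or_lt with h0 | hpos
  · have : z = r := dist_eq_zero.1 (hzr.symm.trans h0.symm)
    rwa [infDist_zero_of_mem (hinv z (this ▸ hr) t ht)]
  have hsmall : infDist z R * Real.exp (L * T) ≤ 1 := by
    calc infDist z R * Real.exp (L * T) ≤ Real.exp (-(L * T)) * Real.exp (L * T) := by
          gcongr; exact hz.trans (min_le_right _ _)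
      _ = 1 := by rw [← Real.exp_add]; simp
  calc infDist (φ t z) R ≤ dist (φ t z) (φ t r) := infDist_le_dist_of_mem (hinv r hr t ht)
    _ ≤ infDist z R * Real.exp (L * t) :=
        h _ _ T _ (hφ.isSolOf z) (hφ.isSolOf r) (fun s hs => hinv r hr s hs.1) hpos
          (by simp [hφ.1, hzr]) hsmall t ⟨ht, htT⟩
    _ ≤ infDist z R * (Real.exp ((L + 1) * T) * Real.exp (-1 * t)) := by
        rw [← Real.exp_add]
        gcongr
        nlinarith
    _ = _ := mul_comm _ _

theorem IsFlowOf.mem_domAttr_of_map_mem [ProperSpace α] {F : α → α} (hF : LocallyLipschitz F)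
    {φ : ℝ → α → α} (hφ : IsFlowOf F φ) {A : Set α} {z : α} {s : ℝ} (hs : 0 ≤ s)
    (h : φ s z ∈ DomAttr φ A) : z ∈ DomAttr φ A := by
  have h' := (show Tendsto (fun t => infDist (φ t (φ s z)) A) atTop (nhds 0) from h).comp
    (tendsto_atTop_add_const_right atTop (-s) tendsto_id)
  refine h'.congr' ?_
  filter_upwards [eventually_ge_atTop s] with t ht
  have : φ t z = φ (t + -s) (φ s z) := by
    rw [← hφ.map_add hF hs (by linarith)]
    congr 1
    ring
  simp [this]

/-- If every trajectory issued from a compact set `R` reaches an open set `V` whose points remain in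
`R` forever, then some neighbourhood of `R` is absorbed by `R` in uniform finite time. -/
theorem IsFlowOf.exists_absorbing_time [ProperSpace α] {F : α → α} (hF : LocallyLipschitz F)
    {φ : ℝ → α → α} (hφ : IsFlowOf F φ) {V R : Set α} (hR : IsCompact R) (hV : IsOpen V)
    (hVR : ∀ z ∈ V, ∀ t ≥ (0 : ℝ), φ t z ∈ R) (hRV : ∀ z ∈ R, ∃ t ≥ (0 : ℝ), φ t z ∈ V) :
    ∃ T : ℝ, ∃ W, IsOpen W ∧ R ⊆ W ∧ ∀ z ∈ W, ∀ t ≥ T, φ t z ∈ R := by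
  refine hR.induction_on (p := fun s => ∃ T : ℝ, ∃ W, IsOpen W ∧ s ⊆ W ∧
    ∀ z ∈ W, ∀ t ≥ T, φ t z ∈ R) ⟨0, ∅, isOpen_empty, subset_rfl, by simp⟩ ?_ ?_ ?_
  · rintro s s' hss' ⟨T, W, hW, hsW, h⟩
    exact ⟨T, W, hW, hss'.trans hsW, h⟩
  · rintro s s' ⟨T, W, hW, hsW, h⟩ ⟨T', W', hW', hsW', h'⟩
    refine ⟨max T T', W ∪ W', hW.union hW', union_subset_union hsW hsW', ?_⟩
    rintro z (hz | hz) t ht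
    · exact h z hz t ((le_max_left _ _).trans ht)
    · exact h' z hz t ((le_max_right _ _).trans ht)
  · intro z hz
    obtain ⟨t, ht, htV⟩ := hRV z hz
    have hW : IsOpen (φ t ⁻¹' V) := hV.preimage (hφ.continuous hF ht)
    refine ⟨φ t ⁻¹' V, mem_nhdsWithin_of_mem_nhds (hW.mem_nhds htV), t, _, hW, subset_rfl,
      fun x hx s hs => ?_⟩
    have := hVR _ hx (s - t) (sub_nonneg.2 hs)
    rwa [← hφ.map_add hF ht (sub_nonneg.2 hs), add_sub_cancel] at this

end Flow

/-- **Lemma** (existence of a locally exponentially stable sandwiched compact set). -/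
theorem sandwiched_LES_set
    {m : ℕ} (F : Euc m → Euc m) (hF : ContDiff ℝ (⊤ : ℕ∞) F)
    (𝒞 : Set (Euc m)) (h𝒞 : IsClosed 𝒞)
    (φ : ℝ → Euc m → Euc m) (hφ : IsFlowOf F φ)
    (hinv : ∀ z ∈ 𝒞, ∀ t ≥ (0:ℝ), φ t z ∈ 𝒞)
    (𝒜 : Set (Euc m)) (h𝒜 : IsCompact 𝒜) (h𝒜𝒞 : 𝒜 ⊆ 𝒞)
    (hLAS : IsLAS φ 𝒜) (hdom : DomAttr φ 𝒜 ⊆ 𝒞)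
    (𝒮 : Set (Euc m)) (h𝒮 : IsCompact 𝒮) (h𝒮𝒞 : 𝒮 ⊆ 𝒞) (hint : 𝒜 ⊆ interior 𝒮) :
    ∃ R : Set (Euc m), IsCompact R ∧ 𝒜 ⊆ R ∧ R ⊆ 𝒮 ∧ IsLES φ R ∧
      DomAttr φ R = DomAttr φ 𝒜 := by
  have hFL : LocallyLipschitz F := (hF.of_le (by exact_mod_cast le_top)).locallyLipschitz
  rcases 𝒜.eq_empty_or_nonempty with rfl | hne
  · exact ⟨∅, isCompact_empty, subset_rfl, empty_subset _,
      ExpBound.isLES ⟨1, one_pos, 1, one_pos, 1, one_pos, by simp⟩, rfl⟩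
  obtain ⟨hstab, U, hU, h𝒜U, hUattr⟩ := hLAS
  obtain ⟨ε, hε, hεU⟩ := h𝒜.exists_cthickening_subset_open (hU.inter isOpen_interior)
    (subset_inter h𝒜U hint)
  obtain ⟨δ, hδ, hδε⟩ := hstab ε hε
  let R : Set (Euc m) := {z | ∀ t ≥ (0 : ℝ), infDist (φ t z) 𝒜 ≤ ε}
  let V : Set (Euc m) := {z | infDist z 𝒜 < δ}
  have hV : IsOpen V := isOpen_lt (continuous_infDist_pt 𝒜) continuous_const
  have hRinv : ∀ z ∈ R, ∀ t ≥ (0 : ℝ), φ t z ∈ R := fun z hz t ht s hs => by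
    rw [← hφ.map_add hFL ht hs]
    exact hz _ (add_nonneg ht hs)
  have hVsub : V ⊆ R := fun z hz t ht => (hδε z hz t ht).le
  have h𝒜V : 𝒜 ⊆ V := fun z hz => by simpa [V, infDist_zero_of_mem hz] using hδ
  have hRthick : R ⊆ cthickening ε 𝒜 := fun z hz => by
    have h := hz 0 le_rfl
    rw [hφ.1] at h
    obtain ⟨a, ha, hza⟩ := h𝒜.exists_infDist_eq_dist hne z
    exact mem_cthickening_of_dist_le z a ε 𝒜 ha (hza ▸ h)
  have hRclosed : IsClosed R := by
    have : R = ⋂ t ∈ Ici (0 : ℝ), {z | infDist (φ t z) 𝒜 ≤ ε} := by ext; simp [R]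
    rw [this]
    exact isClosed_biInter fun t ht => isClosed_le
      ((continuous_infDist_pt 𝒜).comp (hφ.continuous hFL ht)) continuous_const
  have hRcomp : IsCompact R := h𝒜.cthickening.of_isClosed_subset hRclosed hRthick
  have hRattr : ∀ z ∈ R, z ∈ DomAttr φ 𝒜 := fun z hz => hUattr z (hεU (hRthick hz)).1
  have hDV : ∀ z ∈ DomAttr φ 𝒜, ∃ t ≥ (0 : ℝ), φ t z ∈ V := fun z hz =>
    ((eventually_ge_atTop 0).and (Tendsto.eventually_lt_const hδ hz)).exists
  obtain ⟨T, W, hW, hRW, hWabs⟩ := hφ.exists_absorbing_time hFL hRcomp hV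
    (fun z hz => hRinv z (hVsub hz)) (fun z hz => hDV z (hRattr z hz))
  have hRne : R.Nonempty := hne.mono (h𝒜V.trans hVsub)
  obtain ⟨d, hd, hdW⟩ := hRcomp.exists_cthickening_subset_open hW hRW
  have habs : ∀ z, infDist z R ≤ d → ∀ t ≥ T, φ t z ∈ R := fun z hz => by
    obtain ⟨r, hr, hzr⟩ := hRcomp.exists_infDist_eq_dist hRne z
    exact hWabs z (hdW (mem_cthickening_of_dist_le z r d R hr (hzr ▸ hz)))
  refine ⟨R, hRcomp, h𝒜V.trans hVsub, fun z hz => interior_subset (hεU (hRthick hz)).2,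
    (hφ.expBound_of_absorbing hFL hRcomp hRne hRinv hd habs).isLES, ?_⟩
  ext z
  constructor
  · intro hz
    obtain ⟨t, ht, htd⟩ :=
      ((eventually_ge_atTop (0 : ℝ)).and (Tendsto.eventually_lt_const hd hz)).exists
    refine hφ.mem_domAttr_of_map_mem hFL ht
      (hφ.mem_domAttr_of_map_mem hFL (le_max_right T 0) (hRattr _ ?_))
    exact habs _ htd.le _ (le_max_left _ _)
  · intro hz
    obtain ⟨t, ht, htV⟩ := hDV z hz
    refine hφ.mem_domAttr_of_map_mem hFL ht (tendsto_const_nhds.congr' ?_)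
    filter_upwards [eventually_ge_atTop 0] with s hs
    exact (infDist_zero_of_mem (hRinv _ (hVsub htV) s hs)).symm
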